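/- Let e and f be real numbers with e ≥ 1 and f ≥ 1, and let (c_{n,k}(q))_{n,k ≥ 0} be defined by c_{0,0}(q) = 1, c_{n,k}(q) = 0 unless n ≥ k ≥ 0, and for n ≥ 1 by c_{n,0}(q) = ((f − 1) + e q)·c_{n−1,0}(q) + e f q·c_{n−1,1}(q) and, for k ≥ 1, c_{n,k}(q) = c_{n−1,k−1}(q) + (1 + e q)·c_{n−1,k}(q) + e q·c_{n−1,k+1}(q). Then the Hankel matrix (c_{i+j,0}(q))_{i,j ≥ 0} is q-totally positive: every minor (determinant of a k × k submatrix with strictly increasing row indices and strictly increasing column indices) is a polynomial in q with nonnegative real coefficients. -/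

import Mathlib

open Polynomial

/-- Coefficientwise nonnegativity. -/
def QNN (p : ℝ[X]) : Prop := ∀ n, 0 ≤ p.coeff n

theorem QNN.add {p q : ℝ[X]} (hp : QNN p) (hq : QNN q) : QNN (p + q) := fun n => by
  rw [coeff_add]; exact add_nonneg (hp n) (hq n)

theorem QNN.mul {p q : ℝ[X]} (hp : QNN p) (hq : QNN q) : QNN (p * q) := fun n => by
  rw [coeff_mul]; exact Finset.sum_nonneg fun x _ => mul_nonneg (hp _) (hq _)

theorem QNN.zero : QNN 0 := fun n => by simp

theorem QNN.const {a : ℝ} (ha : 0 ≤ a) : QNN (C a) := fun n => by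
  rw [coeff_C]; split_ifs <;> simp [ha]

theorem QNN.one : QNN 1 := by simpa using QNN.const (a := 1) zero_le_one

theorem QNN.X : QNN (X : ℝ[X]) := fun n => by
  rw [coeff_X]; split_ifs <;> simp

theorem QNN.sum {ι : Type*} (s : Finset ι) (g : ι → ℝ[X]) (h : ∀ i ∈ s, QNN (g i)) :
    QNN (∑ i ∈ s, g i) := fun n => by
  rw [finsetSum_coeff]; exact Finset.sum_nonneg fun i hi => h i hi n

theorem det_mul_expand {m N : ℕ} (A : Matrix (Fin m) (Fin N) ℝ[X]) (B : Matrix (Fin N) (Fin m) ℝ[X]) :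
    (A * B).det = ∑ p : Fin m → Fin N, (∏ i, A i (p i)) * (B.submatrix p id).det := by
  have h1 : A * B = fun i => ∑ k, A i k • B k := by
    funext i j
    simp [Matrix.mul_apply, Finset.sum_apply]
  rw [h1]
  change (Matrix.detRowAlternating (R := ℝ[X]) (n := Fin m)).toMultilinearMap _ = _
  rw [MultilinearMap.map_sum]
  refine Finset.sum_congr rfl fun p _ => ?_
  rw [MultilinearMap.map_smul_univ]
  rfl

theorem factorial_det_mul {m N : ℕ} (A : Matrix (Fin m) (Fin N) ℝ[X])
    (B : Matrix (Fin N) (Fin m) ℝ[X]) :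
    (m.factorial : ℝ[X]) * (A * B).det
      = ∑ p : Fin m → Fin N, (A.submatrix id p).det * (B.submatrix p id).det := by
  have h1 : ∀ σ : Equiv.Perm (Fin m), (A * B).det =
      ∑ p : Fin m → Fin N, ((Equiv.Perm.sign σ : ℤ) : ℝ[X]) * (∏ i, A i (p (σ i)))
        * (B.submatrix p id).det := by
    intro σ
    rw [det_mul_expand]
    rw [← (Equiv.arrowCongr σ.symm (Equiv.refl (Fin N))).sum_comp]
    refine Finset.sum_congr rfl fun p _ => ?_
    have : (B.submatrix (fun i => p (σ i)) id).det
        = ((Equiv.Perm.sign σ : ℤ) : ℝ[X]) * (B.submatrix p id).det := by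
      rw [← Matrix.det_permute]; rfl
    have h2 : (Equiv.arrowCongr σ.symm (Equiv.refl (Fin N))) p = fun i => p (σ i) := by
      funext i; simp [Equiv.arrowCongr]
    rw [h2, this]
    ring
  have h2 : ∑ σ : Equiv.Perm (Fin m), (A * B).det = (m.factorial : ℝ[X]) * (A * B).det := by
    rw [Finset.sum_const, Finset.card_univ, Fintype.card_perm, Fintype.card_fin, nsmul_eq_mul]
  rw [← h2, Finset.sum_congr rfl fun σ _ => h1 σ, Finset.sum_comm]
  refine Finset.sum_congr rfl fun p _ => ?_
  rw [← Finset.sum_mul]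
  congr 1
  rw [← Matrix.det_transpose, Matrix.det_apply']
  rfl

theorem qnn_det_mul {m N : ℕ} (A : Matrix (Fin m) (Fin N) ℝ[X]) (B : Matrix (Fin N) (Fin m) ℝ[X])
    (hA : ∀ p : Fin m → Fin N, StrictMono p → QNN (A.submatrix id p).det)
    (hB : ∀ p : Fin m → Fin N, StrictMono p → QNN (B.submatrix p id).det) :
    QNN (A * B).det := by
  have key : QNN ((m.factorial : ℝ[X]) * (A * B).det) := by
    rw [factorial_det_mul]
    refine QNN.sum _ _ fun p _ => ?_
    by_cases hp : Function.Injective p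
    · set τ := Tuple.sort p with hτ
      have hmono : StrictMono (p ∘ τ) :=
        (Tuple.monotone_sort p).strictMono_of_injective (hp.comp τ.injective)
      have h := (hA _ hmono).mul (hB _ hmono)
      have e1 : (A.submatrix id (p ∘ τ)).det
          = ((Equiv.Perm.sign τ : ℤ) : ℝ[X]) * (A.submatrix id p).det := by
        rw [← Matrix.det_permute']; rfl
      have e2 : (B.submatrix (p ∘ τ) id).det
          = ((Equiv.Perm.sign τ : ℤ) : ℝ[X]) * (B.submatrix p id).det := by
        rw [← Matrix.det_permute]; rfl
      rw [e1, e2] at h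
      have e3 : ((Equiv.Perm.sign τ : ℤ) : ℝ[X]) * ((Equiv.Perm.sign τ : ℤ) : ℝ[X]) = 1 := by
        rcases Int.units_eq_one_or (Equiv.Perm.sign τ) with h | h <;> simp [h]
      rw [mul_mul_mul_comm, e3, one_mul] at h
      exact h
    · rw [Function.Injective] at hp
      push Not at hp
      obtain ⟨a, b, hab, hne⟩ := hp
      have : (B.submatrix p id).det = 0 := Matrix.det_zero_of_row_eq hne (by
        funext k; simp [hab])
      rw [this, mul_zero]
      exact QNN.zero
  intro n
  have h := key n
  rw [← C_eq_natCast, coeff_C_mul] at h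
  exact nonneg_of_mul_nonneg_right h (by positivity)

theorem det_last_row {m : ℕ} (A : Matrix (Fin (m+1)) (Fin (m+1)) ℝ[X])
    (h : ∀ b : Fin m, A (Fin.last m) b.castSucc = 0) :
    A.det = A (Fin.last m) (Fin.last m) * (A.submatrix Fin.castSucc Fin.castSucc).det := by
  rw [Matrix.det_succ_row A (Fin.last m), Fin.sum_univ_castSucc]
  have e : (-1 : ℝ[X]) ^ (m + m) = 1 := by rw [← two_mul, pow_mul]; simp
  simp [h, e]

theorem det_last_col {m : ℕ} (A : Matrix (Fin (m+1)) (Fin (m+1)) ℝ[X])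
    (h : ∀ b : Fin m, A b.castSucc (Fin.last m) = 0) :
    A.det = A (Fin.last m) (Fin.last m) * (A.submatrix Fin.castSucc Fin.castSucc).det := by
  rw [← Matrix.det_transpose, det_last_row _ (by simpa using h), ← Matrix.det_transpose]
  rfl

theorem det_tridiag {m : ℕ} (A : Matrix (Fin (m+2)) (Fin (m+2)) ℝ[X])
    (h : ∀ b : Fin m, A (Fin.last _) b.castSucc.castSucc = 0)
    (h' : ∀ b : Fin m, A b.castSucc.castSucc (Fin.last _) = 0) :
    A.det = A (Fin.last _) (Fin.last _) * (A.submatrix Fin.castSucc Fin.castSucc).det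
      - A (Fin.last _) (Fin.last m).castSucc * A (Fin.last m).castSucc (Fin.last _) *
        (A.submatrix (fun u : Fin m => u.castSucc.castSucc)
          (fun u : Fin m => u.castSucc.castSucc)).det := by
  rw [Matrix.det_succ_row A (Fin.last (m+1)), Fin.sum_univ_castSucc, Fin.sum_univ_castSucc]
  have e : (-1 : ℝ[X]) ^ (m + 1 + (m + 1)) = 1 := by rw [← two_mul, pow_mul]; simp
  have e' : (-1 : ℝ[X]) ^ (m + 1 + m) = -1 := by
    rw [show m + 1 + m = 2 * m + 1 by ring, pow_succ, pow_mul]; simp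
  have s1 : (Fin.last m).castSucc.succAbove (Fin.last m) = Fin.last (m+1) := by
    rw [Fin.succAbove_castSucc_self]; simp
  have s2 : ∀ b : Fin m, (Fin.last m).castSucc.succAbove b.castSucc = b.castSucc.castSucc := by
    intro b
    rw [Fin.succAbove_of_castSucc_lt]
    simp [Fin.lt_def]
  have d : (A.submatrix Fin.castSucc (Fin.last m).castSucc.succAbove).det
      = A (Fin.last m).castSucc (Fin.last _) * (A.submatrix (fun u : Fin m => u.castSucc.castSucc)
          (fun u : Fin m => u.castSucc.castSucc)).det := by
    rw [det_last_col]
    · rw [Matrix.submatrix_apply, s1, Matrix.submatrix_submatrix]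
      congr 2
      congr 1
      funext b
      exact s2 b
    · intro b
      rw [Matrix.submatrix_apply, s1, h']
  simp only [h, Fin.succAbove_last, d, Fin.val_last, Fin.val_castSucc, e, e']
  simp
  ring

/-- Tridiagonal coefficient matrix. -/
noncomputable def tri (b l : ℕ → ℝ[X]) (i k : ℕ) : ℝ[X] :=
  if k = i + 1 then 1 else if i = k then b k else if i = k + 1 then l k else 0

theorem tri_up (b l : ℕ → ℝ[X]) (i : ℕ) : tri b l i (i+1) = 1 := by simp [tri]
theorem tri_diag (b l : ℕ → ℝ[X]) (i : ℕ) : tri b l i i = b i := by simp [tri]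
theorem tri_down (b l : ℕ → ℝ[X]) (i : ℕ) : tri b l (i+1) i = l i := by
  simp [tri]; omega
theorem tri_zero (b l : ℕ → ℝ[X]) (i k : ℕ) (h : i + 1 < k ∨ k + 1 < i) : tri b l i k = 0 := by
  unfold tri
  rw [if_neg (by omega), if_neg (by omega), if_neg (by omega)]

/-- Minor given by functions on the naturals. -/
noncomputable def mnr (J : ℕ → ℕ → ℝ[X]) (r c : ℕ → ℕ) (m : ℕ) : ℝ[X] :=
  (Matrix.of fun u v : Fin m => J (r u) (c v)).det

theorem tri_tp (b l : ℕ → ℝ[X]) (x y z : ℝ[X]) (hx : QNN x) (hy : QNN y) (hz : QNN z)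
    (hb0 : b 0 = y + x * z) (hl0 : l 0 = x * (y + z)) (hb : ∀ k, b (k+1) = 1 + x)
    (hl : ∀ k, l (k+1) = x)
    (r c : ℕ → ℕ) (hr : StrictMono r) (hc : StrictMono c) (m : ℕ) :
    QNN (mnr (tri b l) r c m) ∧ QNN (mnr (tri b l) r c (m+1)) ∧
    (r m = c m → ∃ P Q R, QNN P ∧ QNN Q ∧ QNN R ∧ mnr (tri b l) r c (m+1) = P + x * Q + R ∧
      l (r m) * mnr (tri b l) r c m = x * (P + Q)) := by
  have hJ : ∀ i k, QNN (tri b l i k) := by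
    intro i k
    unfold tri
    split_ifs
    · exact QNN.one
    · rcases k with _ | k
      · rw [hb0]; exact hy.add (hx.mul hz)
      · rw [hb]; exact QNN.one.add hx
    · rcases k with _ | k
      · rw [hl0]; exact hx.mul (hy.add hz)
      · rw [hl]; exact hx
    · exact QNN.zero
  induction m with
  | zero =>
    have h0 : mnr (tri b l) r c 0 = 1 := by simp [mnr]
    have h1 : mnr (tri b l) r c 1 = tri b l (r 0) (c 0) := by simp [mnr]
    refine ⟨h0 ▸ QNN.one, h1 ▸ hJ _ _, fun h => ?_⟩
    simp only [zero_add]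
    rw [h1, h0, ← h, tri_diag]
    rcases r 0 with _ | k
    · exact ⟨y, z, 0, hy, hz, QNN.zero, by rw [hb0]; ring, by rw [hl0]; ring⟩
    · exact ⟨0, 1, 1, QNN.zero, QNN.one, QNN.one, by rw [hb]; ring, by rw [hl]; ring⟩
  | succ m ih =>
    obtain ⟨ih0, ih1, ih2⟩ := ih
    refine ⟨ih1, ?_⟩
    have hrm : ∀ b : Fin m, r b < r m := fun b => hr b.2
    have hcm : ∀ b : Fin m, c b < c m := fun b => hc b.2
    have hr1 : r m < r (m+1) := hr (Nat.lt_succ_self m)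
    have hc1 : c m < c (m+1) := hc (Nat.lt_succ_self m)
    have hrm' : ∀ b : Fin (m+1), r b ≤ r m := fun b => hr.monotone (Nat.lt_succ_iff.1 b.2)
    have hcm' : ∀ b : Fin (m+1), c b ≤ c m := fun b => hc.monotone (Nat.lt_succ_iff.1 b.2)
    have hrow : (c m + 1 < r (m+1)) → mnr (tri b l) r c (m+1+1)
        = tri b l (r (m+1)) (c (m+1)) * mnr (tri b l) r c (m+1) := by
      intro h
      unfold mnr
      rw [det_last_row]
      · rfl
      · intro k
        have := hcm' k
        exact tri_zero _ _ _ _ (Or.inr (by simp only [Fin.val_last, Fin.val_castSucc]; omega))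
    have hcol : (r m + 1 < c (m+1)) → mnr (tri b l) r c (m+1+1)
        = tri b l (r (m+1)) (c (m+1)) * mnr (tri b l) r c (m+1) := by
      intro h
      unfold mnr
      rw [det_last_col]
      · rfl
      · intro k
        have := hrm' k
        exact tri_zero _ _ _ _ (Or.inl (by simp only [Fin.val_last, Fin.val_castSucc]; omega))
    by_cases heq : r (m+1) = c (m+1)
    · by_cases hadj : c m + 1 < r (m+1) ∨ r m + 1 < c (m+1)
      · have hM := hadj.elim hrow hcol
        obtain ⟨k, hk⟩ : ∃ k, r (m+1) = k + 1 := ⟨r (m+1) - 1, by omega⟩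
        rw [← heq, tri_diag, hk, hb] at hM
        refine ⟨hM ▸ (QNN.one.add hx).mul ih1, fun _ => ?_⟩
        exact ⟨0, _, _, QNN.zero, ih1, ih1, by rw [hM]; ring, by rw [hk, hl]; ring⟩
      · have er : r (m+1) = r m + 1 := by omega
        have ec : c (m+1) = r m + 1 := by omega
        have ecm : c m = r m := by omega
        obtain ⟨P, Q, R, hP, hQ, hR, e1, e2⟩ := ih2 ecm.symm
        have hM : mnr (tri b l) r c (m+1+1) = (1 + x) * mnr (tri b l) r c (m+1)
            - l (r m) * mnr (tri b l) r c m := by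
          have : mnr (tri b l) r c (m+1+1) = tri b l (r (m+1)) (c (m+1)) * mnr (tri b l) r c (m+1)
            - tri b l (r (m+1)) (c m) * tri b l (r m) (c (m+1)) * mnr (tri b l) r c m := by
            unfold mnr
            rw [det_tridiag]
            · rfl
            · intro k
              have := hcm k
              exact tri_zero _ _ _ _ (Or.inr (by simp only [Fin.val_last, Fin.val_castSucc]; omega))
            · intro k
              have := hrm k
              exact tri_zero _ _ _ _ (Or.inl (by simp only [Fin.val_last, Fin.val_castSucc]; omega))
          rw [this, er, ec, ecm, tri_diag, tri_down, tri_up, hb, mul_one]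
        have hM' : mnr (tri b l) r c (m+1+1) = P + x * (x * Q + R) + R := by
          rw [hM, e2, e1]; ring
        have hQ' := (hx.mul hQ).add hR
        refine ⟨hM' ▸ (hP.add (hx.mul hQ')).add hR, fun _ => ?_⟩
        exact ⟨P, _, R, hP, hQ', hR, hM', by rw [er, hl, e1]; ring⟩
    · refine ⟨?_, fun h => absurd h heq⟩
      have hM : mnr (tri b l) r c (m+1+1)
          = tri b l (r (m+1)) (c (m+1)) * mnr (tri b l) r c (m+1) := by
        rcases Nat.lt_or_gt_of_ne heq with h | h
        · exact hcol (by omega)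
        · exact hrow (by omega)
      rw [hM]
      exact (hJ _ _).mul ih1

/-- All minors are coefficientwise nonnegative. -/
def TP (J : ℕ → ℕ → ℝ[X]) : Prop := ∀ (m : ℕ) (r c : Fin m → ℕ), StrictMono r → StrictMono c →
  QNN (Matrix.of fun u v : Fin m => J (r u) (c v)).det

theorem extend_strictMono {m : ℕ} (r : Fin m → ℕ) (hr : StrictMono r) :
    ∃ r' : ℕ → ℕ, StrictMono r' ∧ ∀ u : Fin m, r' u = r u := by
  refine ⟨fun n => if h : n < m then r ⟨n, h⟩ else (∑ u, r u) + n + 1, ?_, fun u => by simp⟩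
  refine strictMono_nat_of_lt_succ fun n => ?_
  split_ifs with h1 h2 h2
  · exact hr (by simp [Fin.lt_def])
  · have := Finset.single_le_sum (f := r) (fun _ _ => Nat.zero_le _) (Finset.mem_univ ⟨n, h1⟩)
    omega
  · omega
  · omega

theorem TP.transpose {J : ℕ → ℕ → ℝ[X]} (h : TP J) : TP (fun i k => J k i) := by
  intro m r c hr hc
  rw [← Matrix.det_transpose]
  exact h m c r hc hr

theorem tp_rows {J c : ℕ → ℕ → ℝ[X]} (hJ : TP J) (h00 : c 0 0 = 1) (hz : ∀ k, c 0 (k+1) = 0)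
    (hrec : ∀ n N k, n < N → c (n+1) k = ∑ j : Fin N, c n j * J j k) : TP c := by
  intro m
  induction m with
  | zero => intro r d _ _; simpa using QNN.one
  | succ m ih =>
    intro r d hr hd
    induction hk : r 0 generalizing r d with
    | zero =>
      rcases hd0 : d 0 with _ | k
      · have e : (Matrix.of fun u v : Fin (m+1) => c (r u) (d v)).det
            = (Matrix.of fun u v : Fin m => c (r u.succ) (d v.succ)).det := by
          rw [Matrix.det_succ_row_zero, Fin.sum_univ_succ]
          have : ∀ v : Fin m, c 0 (d v.succ) = 0 := by
            intro v
            have : d 0 < d v.succ := hd (Fin.succ_pos v)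
            obtain ⟨t, ht⟩ : ∃ t, d v.succ = t + 1 := ⟨d v.succ - 1, by omega⟩
            rw [ht, hz]
          simp [hk, hd0, h00, this]
          rfl
        rw [e]
        exact ih _ _ (fun a b h => hr (by simpa using h)) (fun a b h => hd (by simpa using h))
      · rw [Matrix.det_eq_zero_of_row_eq_zero 0]
        · exact QNN.zero
        · intro v
          have : d 0 ≤ d v := hd.monotone (Fin.zero_le v)
          obtain ⟨t, ht⟩ : ∃ t, d v = t + 1 := ⟨d v - 1, by omega⟩
          simp [hk, ht, hz]
    | succ k ihk =>
      have hpos : ∀ u, 0 < r u := fun u => by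
        have : r 0 ≤ r u := hr.monotone (Fin.zero_le u)
        omega
      have hr' : StrictMono (fun u => r u - 1) := fun a b h => by
        have := hr h
        have := hpos a
        dsimp only; omega
      set N := (∑ u, r u) with hN
      have e : (Matrix.of fun u v : Fin (m+1) => c (r u) (d v))
          = (Matrix.of fun (u : Fin (m+1)) (j : Fin N) => c (r u - 1) j) *
            (Matrix.of fun (j : Fin N) (v : Fin (m+1)) => J j (d v)) := by
        ext1 u v
        have h1 := Finset.single_le_sum (f := r) (fun _ _ => Nat.zero_le _) (Finset.mem_univ u)
        have h2 := hpos u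
        rw [Matrix.mul_apply]
        simp only [Matrix.of_apply]
        rw [← hrec (r u - 1) N _ (by omega), Nat.sub_add_cancel h2]
      rw [e]
      apply qnn_det_mul
      · intro p hp
        exact ihk (fun u => r u - 1) (fun u => p u) hr' (fun a b h => hp h) (by simp [hk])
      · intro p hp
        exact hJ _ (fun u => p u) d (fun a b h => hp h) hd

/-- The dual triangle. -/
noncomputable def dualT (b l : ℕ → ℝ[X]) : ℕ → ℕ → ℝ[X]
  | 0, 0 => 1
  | 0, _ + 1 => 0
  | n + 1, 0 => b 0 * dualT b l n 0 + dualT b l n 1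
  | n + 1, k + 1 => l k * dualT b l n k + b (k+1) * dualT b l n (k+1) + dualT b l n (k+2)

theorem dualT_zero (b l : ℕ → ℝ[X]) : ∀ n k, n < k → dualT b l n k = 0
  | 0, 0, h => absurd h (by omega)
  | 0, _ + 1, _ => by simp [dualT]
  | n + 1, 0, h => absurd h (by omega)
  | n + 1, k + 1, h => by
    rw [dualT, dualT_zero b l n k (by omega), dualT_zero b l n (k+1) (by omega),
      dualT_zero b l n (k+2) (by omega)]
    ring

theorem sum_fin_support (g : ℕ → ℝ[X]) (N : ℕ) (s : Finset ℕ) (h1 : ∀ j, N ≤ j → g j = 0)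
    (h2 : ∀ j, j ∉ s → g j = 0) : ∑ j : Fin N, g j = ∑ j ∈ s, g j := by
  rw [Fin.sum_univ_eq_sum_range]
  rw [← Finset.sum_subset (Finset.inter_subset_left (s₁ := Finset.range N) (s₂ := s)),
    ← Finset.sum_subset (Finset.inter_subset_right (s₁ := Finset.range N) (s₂ := s))]
  · intro j hj hj'
    apply h1
    simp only [Finset.mem_inter, Finset.mem_range] at hj'
    by_contra h
    exact hj' ⟨by omega, hj⟩
  · intro j hj hj'
    apply h2
    intro h
    exact hj' (Finset.mem_inter.2 ⟨hj, h⟩)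

/-- For real numbers `e ≥ 1` and `f ≥ 1`, the Hankel matrix `(c_{i+j,0}(q))_{i,j ≥ 0}` of the
first column of the Catalan–Stieltjes matrix defined by
`c_{n,0} = ((f-1) + e q) c_{n-1,0} + e f q c_{n-1,1}` and
`c_{n,k} = c_{n-1,k-1} + (1 + e q) c_{n-1,k} + e q c_{n-1,k+1}` (for `k ≥ 1`)
is `q`-totally positive: every minor has nonnegative coefficients. -/
theorem hankel_q_totally_positive_case2
    (e f : ℝ) (he : 1 ≤ e) (hf : 1 ≤ f)
    (c : ℕ → ℕ → Polynomial ℝ)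
    (h00 : c 0 0 = 1)
    (hz : ∀ n k : ℕ, n < k → c n k = 0)
    (hrec0 : ∀ n : ℕ, c (n + 1) 0 =
      (Polynomial.C (f - 1) + Polynomial.C e * Polynomial.X) * c n 0
        + Polynomial.C (e * f) * Polynomial.X * c n 1)
    (hrec : ∀ n k : ℕ, c (n + 1) (k + 1) =
      c n k + (1 + Polynomial.C e * Polynomial.X) * c n (k + 1)
        + Polynomial.C e * Polynomial.X * c n (k + 2))
    (s : ℕ) (hs : 1 ≤ s)
    (i j : Fin s → ℕ) (hi : StrictMono i) (hj : StrictMono j) (m : ℕ) :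
    0 ≤ (Matrix.det (Matrix.of fun u v : Fin s => c (i u + j v) 0)).coeff m := by
  obtain ⟨b, hb0, hb⟩ : ∃ b : ℕ → ℝ[X], b 0 = C (f - 1) + C e * X ∧ ∀ k, b (k+1) = 1 + C e * X :=
    ⟨fun k => if k = 0 then C (f - 1) + C e * X else 1 + C e * X, by simp, by simp⟩
  obtain ⟨l, hl0, hl⟩ : ∃ l : ℕ → ℝ[X], l 0 = C (e * f) * X ∧ ∀ k, l (k+1) = C e * X :=
    ⟨fun k => if k = 0 then C (e * f) * X else C e * X, by simp, by simp⟩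
  have hJ : TP (tri b l) := by
    intro m r d hr hd
    obtain ⟨r', hr', er⟩ := extend_strictMono r hr
    obtain ⟨d', hd', ed⟩ := extend_strictMono d hd
    have := (tri_tp b l (C e * X) (C (f - 1)) 1 ((QNN.const (by linarith)).mul QNN.X)
      (QNN.const (by linarith)) QNN.one (by rw [hb0]; ring)
      (by rw [hl0, C_mul, C_sub, C_1]; ring) hb hl r' d' hr' hd' m).1
    simpa only [mnr, er, ed] using this
  have hcrec : ∀ n N k, n < N → c (n+1) k = ∑ j : Fin N, c n j * tri b l j k := by
    intro n N k hn
    have h1 : ∀ j, N ≤ j → c n j * tri b l j k = 0 := fun j hj => by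
      rw [hz n j (by omega), zero_mul]
    rcases k with _ | k
    · rw [sum_fin_support (fun j => c n j * tri b l j 0) N {0, 1} h1, Finset.sum_pair (by simp),
        tri_diag, tri_down b l 0, hrec0, hb0, hl0]
      · ring
      · intro j hj
        simp at hj
        rw [tri_zero _ _ _ _ (by omega), mul_zero]
    · rw [sum_fin_support (fun j => c n j * tri b l j (k+1)) N {k, k+1, k+2} h1,
        Finset.sum_insert (by simp), Finset.sum_pair (by simp),
        tri_up, tri_diag, tri_down b l (k+1), hrec, hb, hl]
      · ring
      · intro j hj
        simp at hj
        rw [tri_zero _ _ _ _ (by omega), mul_zero]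
  have hdrec : ∀ n N k, n < N → dualT b l (n+1) k = ∑ j : Fin N, dualT b l n j * tri b l k j := by
    intro n N k hn
    have h1 : ∀ j, N ≤ j → dualT b l n j * tri b l k j = 0 := fun j hj => by
      rw [dualT_zero b l n j (by omega), zero_mul]
    rcases k with _ | k
    · rw [sum_fin_support (fun j => dualT b l n j * tri b l 0 j) N {0, 1} h1,
        Finset.sum_pair (by simp), tri_diag, tri_up b l 0, dualT]
      · ring
      · intro j hj
        simp at hj
        rw [tri_zero _ _ _ _ (by omega), mul_zero]
    · rw [sum_fin_support (fun j => dualT b l n j * tri b l (k+1) j) N {k, k+1, k+2} h1,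
        Finset.sum_insert (by simp), Finset.sum_pair (by simp),
        tri_up b l (k+1), tri_diag, tri_down b l k, dualT]
      · ring
      · intro j hj
        simp at hj
        rw [tri_zero _ _ _ _ (by omega), mul_zero]
  have hC : TP c := tp_rows hJ h00 (fun k => hz _ _ (by omega)) hcrec
  have hD : TP (dualT b l) := tp_rows hJ.transpose (by simp [dualT]) (fun k => by simp [dualT]) hdrec
  have hH : ∀ q p N, p + q < N → c (p + q) 0 = ∑ k : Fin N, c p k * dualT b l q k := by
    intro q
    induction q with
    | zero =>
      intro p N hN
      rw [sum_fin_support (fun k => c p k * dualT b l 0 k) N {0}]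
      · simp [dualT]
      · intro k hk
        rw [hz _ _ (by omega), zero_mul]
      · intro k hk
        simp at hk
        rw [dualT_zero _ _ _ _ (by omega), mul_zero]
    | succ q ih =>
      intro p N hN
      rw [show p + (q + 1) = (p + 1) + q by ring, ih (p+1) N (by omega)]
      simp_rw [hcrec p N _ (by omega), hdrec q N _ (by omega), Finset.sum_mul, Finset.mul_sum]
      rw [Finset.sum_comm]
      refine Finset.sum_congr rfl fun _ _ => Finset.sum_congr rfl fun _ _ => ?_
      ring
  set N := (∑ u, i u) + (∑ u, j u) + 1 with hN
  have e : (Matrix.of fun u v : Fin s => c (i u + j v) 0)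
      = (Matrix.of fun (u : Fin s) (k : Fin N) => c (i u) k) *
        (Matrix.of fun (k : Fin N) (v : Fin s) => dualT b l (j v) k) := by
    ext1 u v
    have h1 := Finset.single_le_sum (f := i) (fun _ _ => Nat.zero_le _) (Finset.mem_univ u)
    have h2 := Finset.single_le_sum (f := j) (fun _ _ => Nat.zero_le _) (Finset.mem_univ v)
    rw [Matrix.mul_apply]
    simp only [Matrix.of_apply]
    exact hH _ _ _ (by omega)
  rw [e]
  refine qnn_det_mul _ _ (fun p hp => ?_) (fun p hp => ?_) m
  · exact hC _ i (fun u => p u) hi (fun a b h => hp h)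
  · exact hD.transpose _ (fun u => p u) j (fun a b h => hp h) hj
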